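/- arXiv:2412.04797 — 5 statements merged into one kernel-verified Lean document; each statement's English description precedes it below -/
import Mathlib

section
/- Let $\rho > 0$, $\alpha \in [0, 2\pi)$, and let $x, y, \theta : [0, \rho(\alpha + 2\pi)] \to \mathbb{R}$ be continuous with $(x(0), y(0), \theta(0)) = (0, 0, \pi/2)$, differentiable on $(0, \rho\alpha)$ and on $(\rho\alpha, \rho(\alpha + 2\pi))$, satisfying $\dot{x}(t) = \cos\theta(t)$ and $\dot{y}(t) = \sin\theta(t)$ on both open intervals, $\dot{\theta}(t) = -1/\rho$ on $(0, \rho\alpha)$, and $\dot{\theta}(t) = 1/\rho$ on $(\rho\alpha, \rho(\alpha + 2\pi))$. Then $x(\rho(\alpha + 2\pi)) = \rho - \rho\cos\alpha$, $y(\rho(\alpha + 2\pi)) = \rho\sin\alpha$, and $\theta(\rho(\alpha + 2\pi)) = \pi/2 - \alpha + 2\pi$. -/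
open Real Set

/-- A continuous function on `[a, b]` whose derivative vanishes on `(a, b)` takes the same value
at both endpoints. -/
theorem eq_endpoints_of_hasDerivAt_zero {f : ℝ → ℝ} {a b : ℝ} (hab : a ≤ b)
    (hf : ContinuousOn f (Icc a b)) (hf' : ∀ t ∈ Ioo a b, HasDerivAt f 0 t) : f b = f a := by
  rcases hab.eq_or_lt with rfl | hlt
  · rfl
  · obtain ⟨c, -, hc⟩ := exists_hasDerivAt_eq_slope f (fun _ => 0) hlt hf hf'
    have hne : b - a ≠ 0 := (sub_pos.2 hlt).ne'
    field_simp at hc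
    linarith

/-- Endpoint of a unit-speed planar curve of constant nonzero curvature `k`. -/
theorem endpoint_of_constant_curvature {x y θ : ℝ → ℝ} {a b k : ℝ} (hab : a ≤ b) (hk : k ≠ 0)
    (hxc : ContinuousOn x (Icc a b)) (hyc : ContinuousOn y (Icc a b))
    (hθc : ContinuousOn θ (Icc a b))
    (hx : ∀ t ∈ Ioo a b, HasDerivAt x (cos (θ t)) t)
    (hy : ∀ t ∈ Ioo a b, HasDerivAt y (sin (θ t)) t)
    (hθ : ∀ t ∈ Ioo a b, HasDerivAt θ k t) :
    x b = x a + (sin (θ b) - sin (θ a)) / k ∧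
    y b = y a - (cos (θ b) - cos (θ a)) / k ∧
    θ b = θ a + k * (b - a) := by
  have h₁ := eq_endpoints_of_hasDerivAt_zero (f := fun t => x t - sin (θ t) / k) hab
    (hxc.sub ((continuous_sin.comp_continuousOn hθc).div_const k)) fun t ht => by
      exact ((hx t ht).sub ((hθ t ht).sin.div_const k)).congr_deriv (by
        rw [mul_div_cancel_right₀ _ hk, sub_self])
  have h₂ := eq_endpoints_of_hasDerivAt_zero (f := fun t => y t + cos (θ t) / k) hab
    (hyc.add ((continuous_cos.comp_continuousOn hθc).div_const k)) fun t ht => by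
      exact ((hy t ht).add ((hθ t ht).cos.div_const k)).congr_deriv (by
        rw [mul_div_cancel_right₀ _ hk, add_neg_cancel])
  have h₃ := eq_endpoints_of_hasDerivAt_zero (f := fun t => θ t - k * t) hab
    (hθc.sub (by fun_prop)) fun t ht => by
      exact ((hθ t ht).sub ((hasDerivAt_id t).const_mul k)).congr_deriv (by
        rw [mul_one, sub_self])
  refine ⟨?_, ?_, ?_⟩
  · rw [sub_div]; linarith
  · rw [sub_div]; linarith
  · linarith

/-- Terminal configuration of the `RL₂π`-path: a clockwise arc of radian `α`
followed by a full counterclockwise circle, starting from `(0, 0, π/2)`. -/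
theorem stmt_4 (ρ α : ℝ) (hρ : 0 < ρ) (hα : α ∈ Set.Ico (0:ℝ) (2 * π))
    (x y θ : ℝ → ℝ)
    (hxc : ContinuousOn x (Set.Icc 0 (ρ * (α + 2 * π))))
    (hyc : ContinuousOn y (Set.Icc 0 (ρ * (α + 2 * π))))
    (hθc : ContinuousOn θ (Set.Icc 0 (ρ * (α + 2 * π))))
    (hx0 : x 0 = 0) (hy0 : y 0 = 0) (hθ0 : θ 0 = π / 2)
    (hx1 : ∀ t ∈ Set.Ioo (0:ℝ) (ρ * α), HasDerivAt x (Real.cos (θ t)) t)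
    (hy1 : ∀ t ∈ Set.Ioo (0:ℝ) (ρ * α), HasDerivAt y (Real.sin (θ t)) t)
    (hθ1 : ∀ t ∈ Set.Ioo (0:ℝ) (ρ * α), HasDerivAt θ (-1 / ρ) t)
    (hx2 : ∀ t ∈ Set.Ioo (ρ * α) (ρ * (α + 2 * π)), HasDerivAt x (Real.cos (θ t)) t)
    (hy2 : ∀ t ∈ Set.Ioo (ρ * α) (ρ * (α + 2 * π)), HasDerivAt y (Real.sin (θ t)) t)
    (hθ2 : ∀ t ∈ Set.Ioo (ρ * α) (ρ * (α + 2 * π)), HasDerivAt θ (1 / ρ) t) :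
    x (ρ * (α + 2 * π)) = ρ - ρ * Real.cos α ∧
    y (ρ * (α + 2 * π)) = ρ * Real.sin α ∧
    θ (ρ * (α + 2 * π)) = π / 2 - α + 2 * π := by
  have h₀ : 0 ≤ ρ * α := mul_nonneg hρ.le hα.1
  have h₁ : ρ * α ≤ ρ * (α + 2 * π) :=
    mul_le_mul_of_nonneg_left (by linarith [pi_pos]) hρ.le
  have hl : Icc 0 (ρ * α) ⊆ Icc 0 (ρ * (α + 2 * π)) := Icc_subset_Icc_right h₁
  have hr : Icc (ρ * α) (ρ * (α + 2 * π)) ⊆ Icc 0 (ρ * (α + 2 * π)) := Icc_subset_Icc_left h₀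
  obtain ⟨hxa, hya, hθa⟩ := endpoint_of_constant_curvature h₀
    (div_ne_zero (by norm_num) hρ.ne') (hxc.mono hl) (hyc.mono hl) (hθc.mono hl) hx1 hy1 hθ1
  obtain ⟨hxb, hyb, hθb⟩ := endpoint_of_constant_curvature h₁
    (one_div_ne_zero hρ.ne') (hxc.mono hr) (hyc.mono hr) (hθc.mono hr) hx2 hy2 hθ2
  have hθa' : θ (ρ * α) = π / 2 - α := by
    rw [hθa, hθ0]
    field_simp
    ring
  have hθb' : θ (ρ * (α + 2 * π)) = π / 2 - α + 2 * π := by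
    rw [hθb, hθa']
    field_simp
    ring
  refine ⟨?_, ?_, hθb'⟩
  · rw [hxb, hxa, hθb', hθa', sin_add_two_pi, sin_pi_div_two_sub, hθ0, sin_pi_div_two, hx0]
    field_simp
    ring
  · rw [hyb, hya, hθb', hθa', cos_add_two_pi, cos_pi_div_two_sub, hθ0, cos_pi_div_two, hy0]
    field_simp
    ring
end

section
/- Let $\rho, \alpha, X_{T0}, Y_{T0}, w_x, w_y \in \mathbb{R}$, and set $x_f = \rho - \rho\cos\alpha$ and $y_f = \rho\sin\alpha$. If $(x_f, y_f) = (X_{T0}, Y_{T0}) - \rho(\alpha + 2\pi)\,(w_x, w_y)$, then $a_1\alpha^2 + a_2\alpha + a_3 = 0$, where $a_1 = \rho^2(w_x^2 + w_y^2)$, $a_2 = 4\pi\rho^2(w_x^2 + w_y^2) - 2\rho(w_y Y_{T0} + w_x X_{T0} - \rho w_x)$, and $a_3 = 4\pi^2\rho^2(w_x^2 + w_y^2) - 4\pi\rho(w_y Y_{T0} + w_x X_{T0} - \rho w_x) + Y_{T0}^2 + X_{T0}^2 - 2\rho X_{T0}$. -/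
open Real

/-- Lemma 1, statement (1): for the `RL₂π`-path, the first-arc radian `α` is a
root of an explicit quadratic equation. -/
theorem stmt_7 (ρ α XT0 YT0 wx wy : ℝ)
    (xf yf : ℝ) (hxf : xf = ρ - ρ * Real.cos α) (hyf : yf = ρ * Real.sin α)
    (h : ((xf, yf) : ℝ × ℝ) = (XT0, YT0) - (ρ * (α + 2 * π)) • (wx, wy)) :
    (ρ ^ 2 * (wx ^ 2 + wy ^ 2)) * α ^ 2
      + (4 * π * ρ ^ 2 * (wx ^ 2 + wy ^ 2)
          - 2 * ρ * (wy * YT0 + wx * XT0 - ρ * wx)) * α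
      + (4 * π ^ 2 * ρ ^ 2 * (wx ^ 2 + wy ^ 2)
          - 4 * π * ρ * (wy * YT0 + wx * XT0 - ρ * wx)
          + YT0 ^ 2 + XT0 ^ 2 - 2 * ρ * XT0) = 0 := by
  obtain ⟨hx, hy⟩ := Prod.ext_iff.mp h
  simp only [Prod.smul_mk, Prod.mk_sub_mk, smul_eq_mul] at hx hy
  rw [hxf] at hx
  rw [hyf] at hy
  linear_combination
    -(XT0 - ρ * (α + 2 * π) * wx - ρ - ρ * Real.cos α) * hx
      - (YT0 - ρ * (α + 2 * π) * wy + ρ * Real.sin α) * hy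
      + ρ ^ 2 * Real.sin_sq_add_cos_sq α
end

section
/- Let $\rho, \alpha, \theta_f, X_{T0}, Y_{T0}, w_x, w_y \in \mathbb{R}$ with $\rho \neq 0$, let $n \in \mathbb{Z}$, and set $x_f = \rho - \rho\cos\alpha$, $y_f = \rho\sin\alpha$. Suppose $\theta_f = \pi/2 - \alpha + 2n\pi$, $(x_f, y_f) = (X_{T0}, Y_{T0}) - \rho(\alpha + 2\pi)\,(w_x, w_y)$, and $\pi/2 - \theta_f + 2(n+1)\pi \neq 0$. Then $w_x = \dfrac{X_{T0}/\rho - \cos(\pi/2 + \theta_f) - 1}{\pi/2 - \theta_f + 2(n+1)\pi}$ and $w_y = \dfrac{Y_{T0}/\rho - \sin(\pi/2 + \theta_f)}{\pi/2 - \theta_f + 2(n+1)\pi}$. -/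
open Real

/-- Lemma 1, statement (1): necessary wind-component conditions for the
`RL₂π`-path. -/
theorem stmt_8 (ρ α θf XT0 YT0 wx wy : ℝ) (hρ : ρ ≠ 0) (n : ℤ)
    (xf yf : ℝ) (hxf : xf = ρ - ρ * Real.cos α) (hyf : yf = ρ * Real.sin α)
    (hθf : θf = π / 2 - α + 2 * n * π)
    (h : ((xf, yf) : ℝ × ℝ) = (XT0, YT0) - (ρ * (α + 2 * π)) • (wx, wy))
    (hden : π / 2 - θf + 2 * (n + 1) * π ≠ 0) :
    wx = (XT0 / ρ - Real.cos (π / 2 + θf) - 1) / (π / 2 - θf + 2 * (n + 1) * π) ∧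
    wy = (YT0 / ρ - Real.sin (π / 2 + θf)) / (π / 2 - θf + 2 * (n + 1) * π) := by
  have hden_eq : π / 2 - θf + 2 * (n + 1) * π = α + 2 * π := by rw [hθf]; ring
  have hangle : π / 2 + θf = π - α + n * (2 * π) := by rw [hθf]; ring
  rw [hden_eq] at hden ⊢
  rw [hangle, Real.cos_add_int_mul_two_pi, Real.sin_add_int_mul_two_pi,
    Real.cos_pi_sub, Real.sin_pi_sub]
  simp only [Prod.smul_mk, Prod.mk_sub_mk, Prod.mk.injEq, smul_eq_mul] at h
  obtain ⟨hx, hy⟩ := h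
  have hX : XT0 = ρ * (1 - Real.cos α + (α + 2 * π) * wx) := by linarith
  have hY : YT0 = ρ * (Real.sin α + (α + 2 * π) * wy) := by linarith
  rw [hX, hY, mul_div_cancel_left₀ _ hρ, mul_div_cancel_left₀ _ hρ,
    eq_div_iff hden, eq_div_iff hden]
  constructor <;> ring
end

section
/- Let $\rho, \alpha, X_{T0}, Y_{T0}, w_x, w_y \in \mathbb{R}$, and set $x_f = -\rho + \rho\cos\alpha$ and $y_f = \rho\sin\alpha$. If $(x_f, y_f) = (X_{T0}, Y_{T0}) - \rho(\alpha + 2\pi)\,(w_x, w_y)$, then $b_1\alpha^2 + b_2\alpha + b_3 = 0$, where $b_1 = \rho^2(w_x^2 + w_y^2)$, $b_2 = 4\pi\rho^2(w_x^2 + w_y^2) - 2\rho(w_y Y_{T0} + w_x X_{T0} + \rho w_x)$, and $b_3 = 4\pi^2\rho^2(w_x^2 + w_y^2) - 4\pi\rho(w_y Y_{T0} + w_x X_{T0} + \rho w_x) + Y_{T0}^2 + X_{T0}^2 + 2\rho X_{T0}$. -/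
open Real

/-- Lemma 1, statement (2): for the `LR₂π`-path, the first-arc radian `α` is a
root of an explicit quadratic equation. -/
theorem stmt_9 (ρ α XT0 YT0 wx wy : ℝ)
    (xf yf : ℝ) (hxf : xf = -ρ + ρ * Real.cos α) (hyf : yf = ρ * Real.sin α)
    (h : ((xf, yf) : ℝ × ℝ) = (XT0, YT0) - (ρ * (α + 2 * π)) • (wx, wy)) :
    (ρ ^ 2 * (wx ^ 2 + wy ^ 2)) * α ^ 2
      + (4 * π * ρ ^ 2 * (wx ^ 2 + wy ^ 2)
          - 2 * ρ * (wy * YT0 + wx * XT0 + ρ * wx)) * α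
      + (4 * π ^ 2 * ρ ^ 2 * (wx ^ 2 + wy ^ 2)
          - 4 * π * ρ * (wy * YT0 + wx * XT0 + ρ * wx)
          + YT0 ^ 2 + XT0 ^ 2 + 2 * ρ * XT0) = 0 := by
  simp only [Prod.smul_mk, Prod.mk_sub_mk, Prod.mk.injEq, smul_eq_mul] at h
  obtain ⟨hx, hy⟩ := h
  have hX : XT0 + ρ - ρ * (α + 2 * π) * wx = ρ * Real.cos α := by linarith
  have hY : YT0 - ρ * (α + 2 * π) * wy = ρ * Real.sin α := by linarith
  have circle : (YT0 - ρ * (α + 2 * π) * wy) ^ 2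
      + (XT0 + ρ - ρ * (α + 2 * π) * wx) ^ 2 = ρ ^ 2 := by
    rw [hX, hY]
    linear_combination ρ ^ 2 * Real.sin_sq_add_cos_sq α
  linear_combination circle
end

section
/- Let $c_1, c_2, c_3, c_4 \in \mathbb{R}$ with $c_3 \neq 0$. Then the function $G(\beta) = c_1\beta^2 + c_2\beta + c_3\cos\beta + c_4$ has at most four zeros in $[0, 2\pi)$. -/
open Real

/-- Rolle's theorem for several zeros: a derivative vanishes strictly between any two consecutive
zeros, so a strictly increasing family of `n + 2` zeros yields `n + 1` zeros of the derivative. -/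
theorem exists_strictMono_deriv_zeros {f f' : ℝ → ℝ} (hf : ∀ x, HasDerivAt f (f' x) x) {n : ℕ}
    {x : Fin (n + 2) → ℝ} (hx : StrictMono x) (hx0 : ∀ i, f (x i) = 0) :
    ∃ y : Fin (n + 1) → ℝ, StrictMono y ∧ (∀ i, f' (y i) = 0) ∧
      ∀ i, y i ∈ Set.Ioo (x i.castSucc) (x i.succ) := by
  have key (i : Fin (n + 1)) : ∃ z ∈ Set.Ioo (x i.castSucc) (x i.succ), f' z = 0 :=
    exists_hasDerivAt_eq_zero (hx Fin.castSucc_lt_succ)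
      (fun z _ => (hf z).continuousAt.continuousWithinAt) (by rw [hx0, hx0]) fun z _ => hf z
  choose y hy hy0 using key
  refine ⟨y, fun i j hij => ?_, hy0, hy⟩
  exact (hy i).2.trans_le ((hx.monotone (Fin.succ_le_castSucc_iff.mpr hij)).trans (hy j).1.le)

theorem eq_pi_of_sin_eq_zero {x : ℝ} (h0 : 0 < x) (h1 : x < 2 * π) (hx : sin x = 0) :
    x = π := by
  have h : sin (x - π) = 0 := by rw [sin_sub_pi, hx, neg_zero]
  have := (sin_eq_zero_iff_of_lt_of_lt (by linarith) (by linarith)).mp h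
  linarith

/-- A set of reals without a strictly increasing family of five elements is covered by four
points. -/
theorem exists_subset_four_of_forall_not_strictMono {S : Set ℝ}
    (hS : ∀ x : Fin 5 → ℝ, StrictMono x → ¬ ∀ i, x i ∈ S) :
    ∃ a b c d : ℝ, S ⊆ {a, b, c, d} := by
  have hcard (t : Finset ℝ) (ht : (t : Set ℝ) ⊆ S) : t.card ≠ 5 := fun h =>
    hS (t.orderEmbOfFin h) (t.orderEmbOfFin h).strictMono
      fun i => ht (t.orderEmbOfFin_mem h i)
  have hfin : S.Finite := by
    by_contra hinf
    obtain ⟨t, ht, h5⟩ := Set.Infinite.exists_subset_card_eq hinf 5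
    exact hcard t ht h5
  lift S to Finset ℝ using hfin
  have hle : S.card ≤ 4 := by
    by_contra! hlt
    obtain ⟨t, ht, h5⟩ := Finset.exists_subset_card_eq (show 5 ≤ S.card from hlt)
    exact hcard t (by exact_mod_cast ht) h5
  obtain ⟨t, ht, h4⟩ := Infinite.exists_superset_card_eq S 4 hle
  refine ⟨t.orderEmbOfFin h4 0, t.orderEmbOfFin h4 1, t.orderEmbOfFin h4 2,
    t.orderEmbOfFin h4 3, fun z hz => ?_⟩
  have hzr : z ∈ Set.range (t.orderEmbOfFin h4) := by
    rw [Finset.range_orderEmbOfFin]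
    exact ht hz
  obtain ⟨i, rfl⟩ := hzr
  fin_cases i <;> simp

/-- The function `G(β) = c₁β² + c₂β + c₃ cos β + c₄` has at most four zeros in
`[0, 2π)`. -/
theorem stmt_16 (c1 c2 c3 c4 : ℝ) (hc3 : c3 ≠ 0) :
    ∃ a b c d : ℝ,
      {β : ℝ | β ∈ Set.Ico (0:ℝ) (2 * π) ∧
        c1 * β ^ 2 + c2 * β + c3 * Real.cos β + c4 = 0} ⊆ {a, b, c, d} := by
  refine exists_subset_four_of_forall_not_strictMono fun x hx hxS => ?_
  have hG (β : ℝ) : HasDerivAt (fun β => c1 * β ^ 2 + c2 * β + c3 * cos β + c4)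
      (2 * c1 * β + c2 - c3 * sin β) β := by
    refine HasDerivAt.congr_deriv
      ((((((hasDerivAt_id β).pow 2).const_mul c1).add
        ((hasDerivAt_id β).const_mul c2)).add ((hasDerivAt_cos β).const_mul c3)).add_const c4) ?_
    simp
    ring
  have hG' (β : ℝ) : HasDerivAt (fun β => 2 * c1 * β + c2 - c3 * sin β)
      (2 * c1 - c3 * cos β) β := by
    refine HasDerivAt.congr_deriv ((((hasDerivAt_id β).const_mul (2 * c1)).add_const c2).sub
      ((hasDerivAt_sin β).const_mul c3)) ?_
    simp
  have hG'' (β : ℝ) : HasDerivAt (fun β => 2 * c1 - c3 * cos β) (c3 * sin β) β := by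
    refine HasDerivAt.congr_deriv (((hasDerivAt_cos β).const_mul c3).const_sub (2 * c1)) ?_
    simp
  obtain ⟨y, hy, hy0, hyx⟩ := exists_strictMono_deriv_zeros hG hx fun i => (hxS i).2
  obtain ⟨z, hz, hz0, hzy⟩ := exists_strictMono_deriv_zeros hG' hy hy0
  obtain ⟨w, hw, hw0, hwz⟩ := exists_strictMono_deriv_zeros hG'' hz hz0
  have hwπ (i : Fin 2) : w i = π := by
    refine eq_pi_of_sin_eq_zero ?_ ?_ ((mul_eq_zero.mp (hw0 i)).resolve_left hc3)
    · exact (hxS _).1.1.trans_lt ((hyx _).1.trans ((hzy _).1.trans (hwz i).1))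
    · exact (hwz i).2.trans ((hzy _).2.trans ((hyx _).2.trans (hxS _).1.2))
  exact (hw (show (0 : Fin 2) < 1 by decide)).ne ((hwπ 0).trans (hwπ 1).symm)
end
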